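/- arXiv:2512.00802 — 2 statements merged into one kernel-verified Lean document; each statement's English description precedes it below -/
import Mathlib

section
/- Let F ⊆ ℂ be a closed set. Then F is an Arakelian set if and only if for every function f : ℂ → ℂ that is continuous on F, holomorphic on the interior of F, and has no zeros on F, there exists a function g : ℂ → ℂ, continuous on F and holomorphic on the interior of F, such that exp(g(z)) = f(z) for all z ∈ F. -/
open Complex Metric Bornology

/-- A closed set `F ⊆ ℂ` is Arakelian if every connected component of its complement
is unbounded, and for every compact `K`, the union of all bounded connected components
of `ℂ \ (F ∪ K)` is bounded. -/
def IsArakelian (F : Set ℂ) : Prop :=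
  (∀ z ∈ Fᶜ, ¬ IsBounded (connectedComponentIn Fᶜ z)) ∧
  (∀ K : Set ℂ, IsCompact K →
    IsBounded {z : ℂ | z ∈ (F ∪ K)ᶜ ∧ IsBounded (connectedComponentIn (F ∪ K)ᶜ z)})

section Aux
open Set Topology

/-- `f` has a continuous logarithm on `K`. -/
def HasLogOn (f : ℂ → ℂ) (K : Set ℂ) : Prop :=
  ∃ g : ℂ → ℂ, ContinuousOn g K ∧ ∀ z ∈ K, Complex.exp (g z) = f z

lemma tietze_ext {s : Set ℂ} (hs : IsClosed s) {f : ℂ → ℂ} (hf : ContinuousOn f s) :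
    ∃ g : ℂ → ℂ, Continuous g ∧ EqOn g f s := by
  obtain ⟨g, hg⟩ := ContinuousMap.exists_restrict_eq hs
    (⟨s.domRestrict f, continuousOn_iff_continuous_domRestrict.mp hf⟩ : C(s, ℂ))
  exact ⟨g, g.continuous, fun x hx => DFunLike.congr_fun hg ⟨x, hx⟩⟩

lemma global_log {f : ℂ → ℂ} (hf : Continuous f) (h0 : ∀ z, f z ≠ 0) :
    ∃ g : ℂ → ℂ, Continuous g ∧ ∀ z, Complex.exp (g z) = f z := by
  obtain ⟨g, ⟨-, hg⟩, -⟩ := Complex.isCoveringMapOn_exp.existsUnique_continuousMap_lifts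
    (⟨f, hf⟩ : C(ℂ, ℂ)) (a₀ := (0 : ℂ)) (Complex.exp_log (h0 0)) (fun x => h0 x)
  exact ⟨g, g.continuous, fun z => congrFun hg z⟩

lemma HasLogOn.mono {f : ℂ → ℂ} {K L : Set ℂ} (h : HasLogOn f K) (hL : L ⊆ K) : HasLogOn f L := by
  obtain ⟨g, hg, he⟩ := h
  exact ⟨g, hg.mono hL, fun z hz => he z (hL hz)⟩

lemma HasLogOn.congr {f f' : ℂ → ℂ} {K : Set ℂ} (h : HasLogOn f K) (hL : EqOn f' f K) :
    HasLogOn f' K := by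
  obtain ⟨g, hg, he⟩ := h
  exact ⟨g, hg, fun z hz => by rw [he z hz, hL hz]⟩

lemma HasLogOn.mul {f f' : ℂ → ℂ} {K : Set ℂ} (h : HasLogOn f K) (h' : HasLogOn f' K) :
    HasLogOn (fun z => f z * f' z) K := by
  obtain ⟨g, hg, he⟩ := h
  obtain ⟨g', hg', he'⟩ := h'
  exact ⟨fun z => g z + g' z, hg.add hg', fun z hz => by rw [Complex.exp_add, he z hz, he' z hz]⟩

lemma HasLogOn.inv {f : ℂ → ℂ} {K : Set ℂ} (h : HasLogOn f K) :
    HasLogOn (fun z => (f z)⁻¹) K := by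
  obtain ⟨g, hg, he⟩ := h
  exact ⟨fun z => - g z, hg.neg, fun z hz => by rw [Complex.exp_neg, he z hz]⟩

lemma HasLogOn.conj {f : ℂ → ℂ} {K : Set ℂ} (h : HasLogOn f K) :
    HasLogOn (fun z => (starRingEnd ℂ) (f z)) K := by
  obtain ⟨g, hg, he⟩ := h
  exact ⟨fun z => (starRingEnd ℂ) (g z), Complex.continuous_conj.comp_continuousOn hg,
    fun z hz => by rw [Complex.exp_conj, he z hz]⟩

lemma HasLogOn.const {c : ℂ} (hc : c ≠ 0) (K : Set ℂ) : HasLogOn (fun _ => c) K :=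
  ⟨fun _ => Complex.log c, continuousOn_const, fun _ _ => Complex.exp_log hc⟩

lemma HasLogOn.of_re_pos {f : ℂ → ℂ} {K : Set ℂ} (hf : ContinuousOn f K)
    (h : ∀ z ∈ K, 0 < (f z).re) : HasLogOn f K :=
  ⟨fun z => Complex.log (f z), hf.clog (fun z hz => Or.inl (h z hz)),
    fun z hz => Complex.exp_log (fun h0 => by have := h z hz; simp [h0] at this)⟩

lemma re_div_pos_of_near {a b : ℂ} (h : ‖a - b‖ < ‖b‖) : 0 < (a / b).re := by
  have hb : b ≠ 0 := by rintro rfl; simp at h; exact absurd h (not_lt.2 (norm_nonneg _))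
  have h1 : ‖a / b - 1‖ < 1 := by
    have : a / b - 1 = (a - b) / b := by field_simp
    rw [this, norm_div, div_lt_one (norm_pos_iff.2 hb)]; exact h
  have h2 := Complex.abs_re_le_norm (a / b - 1)
  have h3 := (abs_lt.1 (lt_of_le_of_lt h2 h1)).1
  simp at h3
  linarith

lemma HasLogOn.of_near {f p : ℂ → ℂ} {K : Set ℂ} (hf : ContinuousOn f K)
    (h : ∀ z ∈ K, ‖f z - p z‖ < ‖p z‖) (hp : HasLogOn p K) : HasLogOn f K := by
  have hp0 : ∀ z ∈ K, p z ≠ 0 := by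
    intro z hz h0
    have := h z hz
    rw [h0] at this; simp at this; exact absurd this (not_lt.2 (norm_nonneg _))
  have hpc : ContinuousOn p K := by
    obtain ⟨g, hg, he⟩ := hp
    exact (hg.cexp).congr (fun z hz => (he z hz).symm)
  have h1 : HasLogOn (fun z => f z / p z) K :=
    HasLogOn.of_re_pos (hf.div hpc hp0) (fun z hz => re_div_pos_of_near (h z hz))
  exact (h1.mul hp).congr (fun z hz => by simp [hp0 z hz])

lemma hasLogOn_closedBall {f : ℂ → ℂ} {R : ℝ} (hR : 0 < R)
    (hf : ContinuousOn f (closedBall 0 R)) (h0 : ∀ z ∈ closedBall (0:ℂ) R, f z ≠ 0) :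
    HasLogOn f (closedBall 0 R) := by
  set r : ℂ → ℂ := fun z => ((R / max R ‖z‖ : ℝ) : ℂ) * z with hr
  have hpos : ∀ z : ℂ, 0 < max R ‖z‖ := fun z => lt_of_lt_of_le hR (le_max_left _ _)
  have hrc : Continuous r := by
    refine (Complex.continuous_ofReal.comp (continuous_const.div (by fun_prop) ?_)).mul continuous_id
    exact fun z => (hpos z).ne'
  have hrm : ∀ z, r z ∈ closedBall (0:ℂ) R := by
    intro z
    rw [mem_closedBall_zero_iff, hr]
    simp only [norm_mul, Complex.norm_real, Real.norm_eq_abs]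
    rw [abs_of_pos (div_pos hR (hpos z)), div_mul_eq_mul_div, div_le_iff₀ (hpos z)]
    exact mul_le_mul_of_nonneg_left (le_max_right _ _) hR.le
  have hri : ∀ z ∈ closedBall (0:ℂ) R, r z = z := by
    intro z hz
    rw [mem_closedBall_zero_iff] at hz
    simp [hr, max_eq_left hz, hR.ne']
  obtain ⟨g, hg, he⟩ := global_log (f := fun z => f (r z)) (hf.comp_continuous hrc hrm)
    (fun z => h0 _ (hrm z))
  exact ⟨g, hg.continuousOn, fun z hz => by rw [he, hri z hz]⟩

/-- clopen argument: `z - a` has a log on `K` when `a` is in an unbounded component of the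
complement -/
lemma hasLogOn_sub {K : Set ℂ} (hK : IsCompact K) {a : ℂ} (ha : a ∈ Kᶜ)
    (hb : ¬ IsBounded (connectedComponentIn Kᶜ a)) : HasLogOn (fun z => z - a) K := by
  -- local constancy
  have key : ∀ b ∈ Kᶜ, ∃ ε > 0, ∀ c, dist c b < ε → 
      (HasLogOn (fun z => z - b) K ↔ HasLogOn (fun z => z - c) K) := by
    intro b hbK
    obtain ⟨ε, hε, hball⟩ := Metric.isOpen_iff.1 hK.isClosed.isOpen_compl b hbK
    refine ⟨ε / 2, by positivity, fun c hc => ?_⟩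
    have hfar : ∀ z ∈ K, ε ≤ dist z b := by
      intro z hz
      by_contra hlt
      exact hball (mem_ball.2 (not_le.1 hlt)) hz
    constructor
    · intro h
      refine HasLogOn.of_near (by fun_prop) (fun z hz => ?_) h
      have := hfar z hz
      rw [dist_eq_norm] at this hc
      have e : z - c - (z - b) = -(c - b) := by ring
      rw [e, norm_neg]; linarith
    · intro h
      refine HasLogOn.of_near (by fun_prop) (fun z hz => ?_) h
      have h1 := hfar z hz
      have h2 := dist_triangle z c b
      have e : z - b - (z - c) = c - b := by ring
      rw [e, ← dist_eq_norm, ← dist_eq_norm]; linarith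
  obtain ⟨M, hM⟩ := hK.isBounded.subset_closedBall (0:ℂ)
  -- find a far point in the component
  have hfar : ∃ b ∈ connectedComponentIn Kᶜ a, M < ‖b‖ := by
    by_contra hcon
    push Not at hcon
    exact hb ((isBounded_closedBall (x := (0:ℂ)) (r := M)).subset
      (fun b hb' => mem_closedBall_zero_iff.2 (hcon b hb')))
  obtain ⟨b, hbc, hbM⟩ := hfar
  have hlogb : HasLogOn (fun z => z - b) K := by
    have hb0 : b ≠ 0 ∨ K = ∅ := by
      by_cases h : b = 0
      · right
        subst h
        ext z
        simp only [mem_empty_iff_false, iff_false]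
        intro hz
        have := mem_closedBall_zero_iff.1 (hM hz)
        simp at hbM
        linarith [norm_nonneg z]
      · left; exact h
    rcases hb0 with hb0 | hKe
    · refine HasLogOn.of_near (p := fun _ => -b) (by fun_prop) (fun z hz => ?_)
        (HasLogOn.const (neg_ne_zero.2 hb0) K)
      have := mem_closedBall_zero_iff.1 (hM hz)
      simp
      linarith
    · subst hKe
      exact ⟨0, continuousOn_empty _, by simp⟩
  -- clopen
  have hpre : IsPreconnected (connectedComponentIn Kᶜ a) := isPreconnected_connectedComponentIn
  have hsub : connectedComponentIn Kᶜ a ⊆ Kᶜ := connectedComponentIn_subset _ _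
  by_contra hcon
  set U := {c : ℂ | c ∈ Kᶜ ∧ HasLogOn (fun z => z - c) K}
  set V := {c : ℂ | c ∈ Kᶜ ∧ ¬ HasLogOn (fun z => z - c) K}
  have hKo := hK.isClosed.isOpen_compl
  have hU : IsOpen U := by
    rw [Metric.isOpen_iff]
    rintro c ⟨hc, hl⟩
    obtain ⟨ε, hε, h⟩ := key c hc
    obtain ⟨ε', hε', h'⟩ := Metric.isOpen_iff.1 hKo c hc
    refine ⟨min ε ε', lt_min hε hε', fun d hd => ⟨h' (ball_subset_ball (min_le_right _ _) hd), ?_⟩⟩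
    exact (h d (lt_of_lt_of_le hd (min_le_left _ _))).1 hl
  have hV : IsOpen V := by
    rw [Metric.isOpen_iff]
    rintro c ⟨hc, hl⟩
    obtain ⟨ε, hε, h⟩ := key c hc
    obtain ⟨ε', hε', h'⟩ := Metric.isOpen_iff.1 hKo c hc
    refine ⟨min ε ε', lt_min hε hε', fun d hd => ⟨h' (ball_subset_ball (min_le_right _ _) hd), ?_⟩⟩
    exact fun hh => hl ((h d (lt_of_lt_of_le hd (min_le_left _ _))).2 hh)
  obtain ⟨c, -, hc1, hc2⟩ := hpre U V hU hV
    (fun c hc => by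
      by_cases h : HasLogOn (fun z => z - c) K
      · exact Or.inl ⟨hsub hc, h⟩
      · exact Or.inr ⟨hsub hc, h⟩)
    ⟨b, hbc, hsub hbc, hlogb⟩ ⟨a, mem_connectedComponentIn ha, ha, hcon⟩
  exact hc2.2 hc1.2

/-- a removable zero -/
def GoodZero (K : Set ℂ) (p : ℂ → ℂ) (a : ℂ) : Prop :=
  ∃ q : ℂ → ℂ, Continuous q ∧ (∀ z, z ≠ a → q z ≠ 0) ∧ HasLogOn q K ∧
    ∃ r₀ > 0, ∀ r, 0 < r → r < r₀ → HasLogOn (fun z => p z / q z) (sphere a r)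

lemma hasLogOn_near {q : ℂ → ℂ} (hq : Continuous q) {b : ℂ} (hb : q b ≠ 0) :
    ∃ r₀ > 0, HasLogOn q (ball b r₀) := by
  have h : ∀ᶠ z in 𝓝 b, ‖q z - q b‖ < ‖q b‖ := by
    have h1 : Filter.Tendsto (fun z => ‖q z - q b‖) (𝓝 b) (𝓝 ‖q b - q b‖) :=
      ((hq.sub continuous_const).norm).tendsto b
    refine h1.eventually_lt_const ?_
    simpa using hb
  obtain ⟨r, hr, h'⟩ := Metric.eventually_nhds_iff_ball.1 h
  exact ⟨r, hr, HasLogOn.of_near (p := fun _ => q b) hq.continuousOn h' (HasLogOn.const hb _)⟩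

lemma hasLogOn_of_goodZeros {K : Set ℂ} (hK : IsCompact K) {R : ℝ} (hR : 0 < R)
    (hKR : K ⊆ closedBall 0 R) (S : Finset ℂ) :
    ∀ p : ℂ → ℂ, Continuous p → (∀ z ∈ closedBall (0:ℂ) R, p z = 0 → z ∈ S) →
    (∀ a ∈ S, a ∉ K ∧ GoodZero K p a) → HasLogOn p K := by
  induction S using Finset.induction_on with
  | empty =>
    intro p hp h0 _
    exact (hasLogOn_closedBall hR hp.continuousOn (fun z hz h => by simpa using h0 z hz h)).mono hKR
  | insert a S haS ih =>
    intro p hp h0 hg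
    obtain ⟨haK, q, hq, hq0, hqK, r₀, hr₀, hlog⟩ := hg a (Finset.mem_insert_self a S)
    have hopen : IsOpen (K ∪ (S : Set ℂ))ᶜ :=
      (hK.isClosed.union S.finite_toSet.isClosed).isOpen_compl
    obtain ⟨r₁, hr₁, hb₁⟩ := Metric.isOpen_iff.1 hopen a (by simp [haK, haS])
    obtain ⟨r, hr, hrlt⟩ := exists_between (lt_min hr₀ hr₁)
    obtain ⟨u, hu, hue⟩ := hlog r hr (hrlt.trans_le (min_le_left _ _))
    obtain ⟨v, hv, hvu⟩ := tietze_ext isClosed_sphere hu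
    have hsub : closedBall a r ⊆ (K ∪ (S : Set ℂ))ᶜ :=
      (closedBall_subset_ball (hrlt.trans_le (min_le_right _ _))).trans hb₁
    classical
    set p' : ℂ → ℂ := (ball a r).piecewise (fun z => Complex.exp (v z)) (fun z => p z / q z) with hp'
    have hne : ∀ z ∈ (ball a r)ᶜ, z ≠ a := by
      rintro z hz rfl
      exact hz (mem_ball_self hr)
    have hout : ∀ z, z ∉ ball a r → p' z = p z / q z := fun z hz => by
      simp only [hp', Set.piecewise, hz, if_false]
    have hin : ∀ z, z ∈ ball a r → p' z = Complex.exp (v z) := fun z hz => by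
      simp only [hp', Set.piecewise, hz, if_true]
    have hp'c : Continuous p' := by
      refine continuous_piecewise ?_ ?_ ?_
      · intro z hz
        rw [frontier_ball a hr.ne'] at hz
        rw [hvu hz, hue z hz]
      · exact (hv.cexp).continuousOn
      · rw [isOpen_ball.isClosed_compl.closure_eq]
        exact hp.continuousOn.div hq.continuousOn (fun z hz => hq0 z (hne z hz))
    have hlog' : HasLogOn p' K := by
      refine ih p' hp'c ?_ ?_
      · intro z hz hz0
        by_cases hzb : z ∈ ball a r
        · rw [hin z hzb] at hz0
          exact absurd hz0 (Complex.exp_ne_zero _)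
        · rw [hout z hzb, div_eq_zero_iff] at hz0
          rcases hz0 with hz0 | hz0
          · have := h0 z hz hz0
            rcases Finset.mem_insert.1 this with h | h
            · exact absurd h (hne z hzb)
            · exact h
          · exact absurd hz0 (hq0 z (hne z hzb))
      · intro b hb
        obtain ⟨hbK, t, ht, ht0, htK, s₀, hs₀, hs⟩ := hg b (Finset.mem_insert_of_mem hb)
        refine ⟨hbK, t, ht, ht0, htK, ?_⟩
        have hba : b ∈ (closedBall a r)ᶜ := fun h => hsub h (Or.inr hb)
        have hba' : b ≠ a := hne b (fun h => hba (ball_subset_closedBall h))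
        obtain ⟨s₁, hs₁, hl₁⟩ := hasLogOn_near hq (hq0 b hba')
        obtain ⟨s₂, hs₂, hl₂⟩ := Metric.isOpen_iff.1 isClosed_closedBall.isOpen_compl b hba
        refine ⟨min s₀ (min s₁ s₂), lt_min hs₀ (lt_min hs₁ hs₂), fun s hs0 hslt => ?_⟩
        have e0 : s < s₀ := hslt.trans_le (min_le_left _ _)
        have e1 : s < s₁ := hslt.trans_le ((min_le_right _ _).trans (min_le_left _ _))
        have e2 : s < s₂ := hslt.trans_le ((min_le_right _ _).trans (min_le_right _ _))
        have hsb : ∀ s', s < s' → sphere b s ⊆ ball b s' := fun s' h =>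
          sphere_subset_closedBall.trans (closedBall_subset_ball h)
        refine ((hs s hs0 e0).mul (hl₁.mono (hsb _ e1)).inv).congr ?_
        intro z hz
        have : z ∉ ball a r := fun h => hl₂ (hsb _ e2 hz) (ball_subset_closedBall h)
        simp only [hout z this]
        rw [div_div, div_mul_eq_mul_div, ← div_eq_mul_inv, div_div, div_eq_div_iff_comm]
    refine (hlog'.mul hqK).congr ?_
    intro z hz
    have hzb : z ∉ ball a r := fun h => hsub (ball_subset_closedBall h) (Or.inl hz)
    simp only [hout z hzb]
    rw [div_mul_cancel₀ _ (hq0 z (hne z hzb))]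

lemma real_linear_form (A : ℂ →L[ℝ] ℂ) :
    ∃ α β : ℂ, ∀ w, A w = α * w + β * (starRingEnd ℂ) w := by
  refine ⟨(A 1 - Complex.I * A Complex.I) / 2, (A 1 + Complex.I * A Complex.I) / 2, fun w => ?_⟩
  have hw : w = w.re • (1:ℂ) + w.im • Complex.I := by
    simp
  have h1 : A w = w.re * A 1 + w.im * A Complex.I := by
    conv_lhs => rw [hw]
    rw [map_add, map_smul, map_smul]; simp
  rw [h1]
  have hc : (starRingEnd ℂ) w = w.re - w.im * Complex.I := by
    apply Complex.ext <;> simp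
  have hw' : w = w.re + w.im * Complex.I := (Complex.re_add_im w).symm
  rw [hc]
  conv_rhs => rw [hw']
  simp only [Complex.add_re, Complex.add_im, Complex.ofReal_re, Complex.ofReal_im, Complex.mul_re,
    Complex.mul_im, Complex.I_re, Complex.I_im]
  have hI : Complex.I * Complex.I = -1 := Complex.I_mul_I
  push_cast
  linear_combination ((w.im * A Complex.I : ℂ)) * hI

lemma goodZero_of_approx {K : Set ℂ} (p q : ℂ → ℂ) (hp : Continuous p) (hq : Continuous q) (a : ℂ)
    (hq0 : ∀ z, z ≠ a → q z ≠ 0) (hqK : HasLogOn q K)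
    (h : ∀ᶠ w in 𝓝 a, w ≠ a → ‖p w - q w‖ < ‖q w‖) :
    GoodZero K p a := by
  obtain ⟨r, hr, h'⟩ := Metric.eventually_nhds_iff_ball.1 h
  refine ⟨q, hq, hq0, hqK, r, hr, fun s hs hsr => ?_⟩
  have hne : ∀ z ∈ sphere a s, z ≠ a := by
    rintro z hz rfl
    simp at hz; linarith
  refine HasLogOn.of_re_pos (hp.continuousOn.div hq.continuousOn (fun z hz => hq0 z (hne z hz))) ?_
  intro z hz
  refine re_div_pos_of_near (h' z ?_ (hne z hz))
  exact closedBall_subset_ball hsr (sphere_subset_closedBall hz)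

lemma goodZero_of_det {K : Set ℂ} (p : ℂ → ℂ) (hp : Continuous p) (a : ℂ) (A : ℂ →L[ℝ] ℂ)
    (hA : HasFDerivAt p A a) (hdet : A.det ≠ 0) (ha : p a = 0)
    (hlog : HasLogOn (fun z => z - a) K) :
    GoodZero K p a ∧ ∀ᶠ w in 𝓝 a, w ≠ a → p w ≠ 0 := by
  obtain ⟨α, β, hAB⟩ := real_linear_form A
  have hinj : ∀ w, A w = 0 → w = 0 := by
    intro w hw
    by_contra hne
    apply hdet
    refine LinearMap.det_eq_zero_iff_ker_ne_bot.2 ?_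
    intro hbot
    exact hne (LinearMap.ker_eq_bot'.1 hbot w hw)
  have hne : ‖α‖ ≠ ‖β‖ := by
    intro heq
    by_cases hα : α = 0
    · have hβ : β = 0 := by rw [hα, norm_zero] at heq; exact norm_eq_zero.1 heq.symm
      have := hinj 1 (by rw [hAB, hα, hβ]; simp)
      exact one_ne_zero this
    · obtain ⟨w, hw⟩ := IsAlgClosed.exists_eq_mul_self (-β / α)
      have hn : ‖w‖ * ‖w‖ = 1 := by
        rw [← norm_mul, ← hw, norm_div, norm_neg, ← heq, div_self (norm_ne_zero_iff.2 hα)]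
      have hw1 : w * (starRingEnd ℂ) w = 1 := by
        rw [Complex.mul_conj, Complex.normSq_eq_norm_sq, sq, hn]; simp
      have hw2 : α * (w * w) = -β := by rw [← hw]; field_simp
      have h0 : w = 0 := by
        apply hinj
        rw [hAB]
        linear_combination (starRingEnd ℂ w) * hw2 - α * w * hw1
      rw [h0] at hn; simp at hn
  have main : ∀ (q : ℂ → ℂ) (l m : ℝ), m < l → Continuous q → HasLogOn q K →
      (∀ w, ‖q w‖ = l * ‖w - a‖) → (∀ w, ‖A (w - a) - q w‖ = m * ‖w - a‖) → 0 ≤ m →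
      GoodZero K p a ∧ ∀ᶠ w in 𝓝 a, w ≠ a → p w ≠ 0 := by
    intro q l m hml hq hqK hql hqm hm
    have h1 := hA.isLittleO.def (c := (l - m) / 2) (by linarith)
    have h2 : ∀ᶠ w in 𝓝 a, w ≠ a → ‖p w - q w‖ < ‖q w‖ := by
      filter_upwards [h1] with w hw hwa
      rw [ha, sub_zero] at hw
      have hpos : 0 < ‖w - a‖ := norm_pos_iff.2 (sub_ne_zero.2 hwa)
      calc ‖p w - q w‖ = ‖(p w - A (w - a)) + (A (w - a) - q w)‖ := by congr 1; ring
        _ ≤ ‖p w - A (w - a)‖ + ‖A (w - a) - q w‖ := norm_add_le _ _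
        _ ≤ (l - m) / 2 * ‖w - a‖ + m * ‖w - a‖ := by rw [hqm]; gcongr
        _ < ‖q w‖ := by rw [hql]; nlinarith
    refine ⟨goodZero_of_approx p q hp hq a ?_ hqK h2, ?_⟩
    · intro z hz
      rw [← norm_pos_iff, hql]
      have hpos : 0 < ‖z - a‖ := norm_pos_iff.2 (sub_ne_zero.2 hz)
      exact mul_pos (by linarith) hpos
    · filter_upwards [h2] with w hw hwa h0
      have := hw hwa
      rw [h0, zero_sub, norm_neg] at this
      exact lt_irrefl _ this
  rcases lt_or_gt_of_ne hne with h | h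
  · refine main (fun w => β * (starRingEnd ℂ) (w - a)) ‖β‖ ‖α‖ h (by fun_prop) ?_ ?_ ?_ (norm_nonneg _)
    · have hβ : β ≠ 0 := norm_pos_iff.1 (lt_of_le_of_lt (norm_nonneg _) h)
      exact (HasLogOn.const hβ K).mul hlog.conj
    · intro w; rw [norm_mul, Complex.norm_conj]
    · intro w; rw [hAB, add_sub_cancel_right, norm_mul]
  · refine main (fun w => α * (w - a)) ‖α‖ ‖β‖ h (by fun_prop) ?_ ?_ ?_ (norm_nonneg _)
    · have hα : α ≠ 0 := norm_pos_iff.1 (lt_of_le_of_lt (norm_nonneg _) h)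
      exact (HasLogOn.const hα K).mul hlog
    · intro w; rw [norm_mul]
    · intro w; rw [hAB, add_sub_cancel_left, norm_mul, Complex.norm_conj]

lemma sard_small {p : ℂ → ℂ} (hp : ContDiff ℝ 1 p) {δ : ℝ} (hδ : 0 < δ) :
    ∃ c : ℂ, ‖c‖ < δ ∧ ∀ z, p z = c → (fderiv ℝ p z).det ≠ 0 := by
  have hd : Differentiable ℝ p := hp.differentiable (by norm_num)
  have h := MeasureTheory.addHaar_image_eq_zero_of_det_fderivWithin_eq_zero
    (MeasureTheory.volume : MeasureTheory.Measure ℂ)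
    (s := {z | (fderiv ℝ p z).det = 0}) (f := p) (f' := fun z => fderiv ℝ p z)
    (fun z _ => (hd z).hasFDerivAt.hasFDerivWithinAt) (fun z hz => hz)
  by_contra hcon
  push Not at hcon
  have hsub : ball (0:ℂ) δ ⊆ p '' {z | (fderiv ℝ p z).det = 0} := by
    intro c hc
    obtain ⟨z, hz, hz'⟩ := hcon c (mem_ball_zero_iff.1 hc)
    exact ⟨z, hz', hz⟩
  have h1 := MeasureTheory.measure_mono_null hsub h
  exact (measure_ball_pos MeasureTheory.volume (0:ℂ) hδ).ne' h1

theorem compact_log {K : Set ℂ} (hK : IsCompact K)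
    (hcomp : ∀ a ∈ Kᶜ, ¬ IsBounded (connectedComponentIn Kᶜ a)) {f : ℂ → ℂ}
    (hf : ContinuousOn f K) (h0 : ∀ z ∈ K, f z ≠ 0) : HasLogOn f K := by
  rcases K.eq_empty_or_nonempty with rfl | hne
  · exact ⟨0, continuousOn_empty _, by simp⟩
  obtain ⟨z₀, hz₀, hmin⟩ := hK.exists_isMinOn hne hf.norm
  set m := ‖f z₀‖ with hm
  have hmpos : 0 < m := norm_pos_iff.2 (h0 z₀ hz₀)
  have hmle : ∀ z ∈ K, m ≤ ‖f z‖ := fun z hz => hmin hz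
  obtain ⟨f₁, hf₁, hff⟩ := tietze_ext hK.isClosed hf
  obtain ⟨p₁, hp₁, hpd, -⟩ := hf₁.exists_contDiff_approx 1 (ε := fun _ => m / 4) continuous_const
    (fun _ => by positivity)
  have hp₁' : ContDiff ℝ 1 p₁ := by exact_mod_cast hp₁
  obtain ⟨c, hc, hreg⟩ := sard_small hp₁' (δ := m / 4) (by positivity)
  set p : ℂ → ℂ := fun z => p₁ z - c with hpdef
  have hpc : Continuous p := hp₁.continuous.sub continuous_const
  have hfp : ∀ z ∈ K, ‖f z - p z‖ < m / 2 := by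
    intro z hz
    have h1 := hpd z
    rw [hff hz, dist_comm, dist_eq_norm] at h1
    calc ‖f z - p z‖ = ‖(f z - p₁ z) + c‖ := by congr 1; simp only [hpdef]; ring
      _ ≤ ‖f z - p₁ z‖ + ‖c‖ := norm_add_le _ _
      _ < m / 2 := by linarith
  have hpK : ∀ z ∈ K, m / 2 < ‖p z‖ := by
    intro z hz
    have h1 := norm_sub_norm_le (f z) (p z)
    have h2 := hfp z hz
    have h3 := hmle z hz
    linarith
  refine HasLogOn.of_near hf (fun z hz => (hfp z hz).trans (hpK z hz)) ?_
  obtain ⟨R₀, hR₀⟩ := hK.isBounded.subset_closedBall (0:ℂ)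
  set R := max R₀ 1
  have hR : 0 < R := lt_of_lt_of_le one_pos (le_max_right _ _)
  have hKR : K ⊆ closedBall 0 R := hR₀.trans (closedBall_subset_closedBall (le_max_left _ _))
  have hgood : ∀ a, p a = 0 → a ∉ K ∧ GoodZero K p a ∧ ∀ᶠ w in 𝓝 a, w ≠ a → p w ≠ 0 := by
    intro a ha
    have haK : a ∉ K := by
      intro h
      have := hpK a h
      rw [ha, norm_zero] at this
      linarith
    refine ⟨haK, ?_⟩
    have hd : HasFDerivAt p (fderiv ℝ p₁ a) a :=
      ((hp₁'.differentiable (by norm_num)) a).hasFDerivAt.sub_const c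
    exact goodZero_of_det p hpc a _ hd (hreg a (sub_eq_zero.1 ha)) ha
      (hasLogOn_sub hK haK (hcomp a haK))
  set Z : Set ℂ := {z | p z = 0} ∩ closedBall 0 R with hZ
  have hZc : IsCompact Z :=
    (isCompact_closedBall (0:ℂ) R).inter_left (isClosed_eq hpc continuous_const)
  have hZf : Z.Finite := by
    by_contra hinf
    obtain ⟨x, hx, hacc⟩ := Set.Infinite.exists_accPt_of_subset_isCompact hinf hZc subset_rfl
    rw [accPt_iff_frequently] at hacc
    refine hacc ?_
    filter_upwards [(hgood x hx.1).2.2] with w hw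
    rintro ⟨h1, h2⟩
    exact hw h1 h2.1
  refine hasLogOn_of_goodZeros hK hR hKR hZf.toFinset p hpc ?_ ?_
  · intro z hz hz0
    rw [Set.Finite.mem_toFinset]
    exact ⟨hz0, hz⟩
  · intro a ha
    rw [Set.Finite.mem_toFinset] at ha
    exact ⟨(hgood a ha.1).1, (hgood a ha.1).2.1⟩

lemma not_bounded_of_subset {C D : Set ℂ} (h : C ⊆ D) (hC : ¬ IsBounded C) : ¬ IsBounded D :=
  fun hD => hC (hD.subset h)

lemma unbounded_ray {x : ℂ} (hx : x ≠ 0) :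
    ¬ IsBounded ((fun t : ℝ => (t : ℂ) * x) '' Set.Ici 1) := by
  intro hb
  obtain ⟨M, hM⟩ := hb.subset_closedBall (0:ℂ)
  have hxp : 0 < ‖x‖ := norm_pos_iff.2 hx
  have h1 := hM ⟨max 1 ((|M| + 1) / ‖x‖), Set.mem_Ici.2 (le_max_left _ _), rfl⟩
  rw [mem_closedBall_zero_iff, norm_mul, Complex.norm_real, Real.norm_eq_abs] at h1
  have h2 : (|M| + 1) / ‖x‖ * ‖x‖ ≤ |max 1 ((|M| + 1) / ‖x‖)| * ‖x‖ := by
    gcongr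
    exact (le_max_right _ _).trans (le_abs_self _)
  rw [div_mul_cancel₀ _ hxp.ne'] at h2
  linarith [le_abs_self M]

lemma inter_ball_components {E : Set ℂ} 
    (hcomp : ∀ a ∈ Eᶜ, ¬ IsBounded (connectedComponentIn Eᶜ a)) {R : ℝ} (hR : 0 < R) :
    ∀ a ∈ (E ∩ closedBall 0 R)ᶜ, ¬ IsBounded (connectedComponentIn (E ∩ closedBall 0 R)ᶜ a) := by
  intro a ha
  by_cases haE : a ∈ E
  · have haR : R < ‖a‖ := by
      by_contra h
      exact ha ⟨haE, mem_closedBall_zero_iff.2 (not_lt.1 h)⟩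
    have ha0 : a ≠ 0 := norm_pos_iff.1 (hR.trans haR)
    refine not_bounded_of_subset ?_ (unbounded_ray ha0)
    refine IsPreconnected.subset_connectedComponentIn ?_ ⟨1, by simp, by simp⟩ ?_
    · exact isPreconnected_Ici.image _ (by fun_prop)
    · rintro _ ⟨t, ht, rfl⟩ ⟨-, h2⟩
      rw [mem_closedBall_zero_iff, norm_mul, Complex.norm_real, Real.norm_eq_abs] at h2
      have ht' : (1:ℝ) ≤ |t| := le_trans ht (le_abs_self t)
      nlinarith
  · exact not_bounded_of_subset (connectedComponentIn_mono a
      (compl_subset_compl.2 inter_subset_left)) (hcomp a haE)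

lemma extend_step {E : Set ℂ} (hE : IsClosed E)
    (hcomp : ∀ a ∈ Eᶜ, ¬ IsBounded (connectedComponentIn Eᶜ a)) {R : ℝ} (hR : 0 < R)
    {h : ℂ → ℂ} (hc : ContinuousOn h E) (h0 : ∀ z ∈ E, h z ≠ 0) :
    ∃ h' : ℂ → ℂ, Continuous h' ∧ EqOn h' h E ∧ ∀ z ∈ closedBall (0:ℂ) R, h' z ≠ 0 := by
  have hK : IsCompact (E ∩ closedBall (0:ℂ) R) := (isCompact_closedBall (0:ℂ) R).inter_left hE
  obtain ⟨g, hg, hge⟩ := compact_log hK (inter_ball_components hcomp hR)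
    (hc.mono inter_subset_left) (fun z hz => h0 z hz.1)
  obtain ⟨G, hG, hGg⟩ := tietze_ext hK.isClosed hg
  classical
  set k : ℂ → ℂ := (closedBall (0:ℂ) R).piecewise (fun z => Complex.exp (G z)) h with hk
  have hkb : EqOn k (fun z => Complex.exp (G z)) (closedBall (0:ℂ) R) :=
    fun z hz => by simp only [hk, Set.piecewise, hz, if_true]
  have hkE : EqOn k h E := by
    intro z hz
    by_cases hzb : z ∈ closedBall (0:ℂ) R
    · rw [hkb hzb]
      simp only
      rw [hGg ⟨hz, hzb⟩, hge z ⟨hz, hzb⟩]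
    · simp only [hk, Set.piecewise, hzb, if_false]
  have hkc : ContinuousOn k (E ∪ closedBall (0:ℂ) R) :=
    (hc.congr hkE).union_of_isClosed ((hG.cexp.continuousOn).congr hkb) hE isClosed_closedBall
  obtain ⟨h', hh', he'⟩ := tietze_ext (hE.union isClosed_closedBall) hkc
  refine ⟨h', hh', fun z hz => (he' (Or.inl hz)).trans (hkE hz), fun z hz => ?_⟩
  rw [he' (Or.inr hz), hkb hz]
  exact Complex.exp_ne_zero _

/-- The hull: complement of the union of the unbounded components of the complement. -/
lemma hull_facts {L : Set ℂ} (hL : IsClosed L) :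
    let E := L ∪ {z : ℂ | z ∈ Lᶜ ∧ IsBounded (connectedComponentIn Lᶜ z)}
    IsClosed E ∧ ∀ a ∈ Eᶜ, ¬ IsBounded (connectedComponentIn Eᶜ a) := by
  intro E
  have hmem : ∀ z, z ∈ Eᶜ ↔ z ∈ Lᶜ ∧ ¬ IsBounded (connectedComponentIn Lᶜ z) := by
    intro z
    simp only [E, mem_compl_iff, mem_union, mem_ofPred_eq]
    tauto
  have hsub : ∀ z ∈ Eᶜ, connectedComponentIn Lᶜ z ⊆ Eᶜ := by
    intro z hz w hw
    rw [hmem] at hz ⊢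
    refine ⟨connectedComponentIn_subset _ _ hw, ?_⟩
    rw [← connectedComponentIn_eq hw]
    exact hz.2
  constructor
  · rw [← isOpen_compl_iff, isOpen_iff_mem_nhds]
    intro z hz
    exact Filter.mem_of_superset ((hL.isOpen_compl.connectedComponentIn).mem_nhds
      (mem_connectedComponentIn ((hmem z).1 hz).1)) (hsub z hz)
  · intro a ha
    refine not_bounded_of_subset ?_ ((hmem a).1 ha).2
    exact isPreconnected_connectedComponentIn.subset_connectedComponentIn
      (mem_connectedComponentIn ((hmem a).1 ha).1) (hsub a ha)

theorem arakelian_log {F : Set ℂ} (hF : IsClosed F) (hA : IsArakelian F) {f : ℂ → ℂ}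
    (hf : ContinuousOn f F) (h0 : ∀ z ∈ F, f z ≠ 0) : HasLogOn f F := by
  obtain ⟨hA1, hA2⟩ := hA
  have hρ : ∀ R : ℝ, ∃ R' : ℝ, R + 1 ≤ R' ∧ 
      {z : ℂ | z ∈ (F ∪ closedBall 0 R)ᶜ ∧
        IsBounded (connectedComponentIn (F ∪ closedBall 0 R)ᶜ z)} ⊆ closedBall 0 R' := by
    intro R
    obtain ⟨M, hM⟩ := (hA2 _ (isCompact_closedBall (0:ℂ) R)).subset_closedBall (0:ℂ)
    exact ⟨max (R + 1) M, le_max_left _ _, hM.trans (closedBall_subset_closedBall (le_max_right _ _))⟩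
  choose ρ hρ1 hρ2 using hρ
  set r : ℕ → ℝ := fun n => Nat.rec 1 (fun _ x => ρ x) n with hr
  have hrs : ∀ n, r (n + 1) = ρ (r n) := fun n => rfl
  have hr1 : ∀ n, r n + 1 ≤ r (n + 1) := fun n => by rw [hrs]; exact hρ1 _
  have hrn : ∀ n : ℕ, (n : ℝ) + 1 ≤ r n := by
    intro n
    induction n with
    | zero => simp [hr]
    | succ n ih => push_cast; linarith [hr1 n]
  have hrpos : ∀ n, 0 < r n := fun n => by
    have := hrn n
    have : (0:ℝ) ≤ n := Nat.cast_nonneg n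
    linarith
  have hrmono : Monotone r := monotone_nat_of_le_succ (fun n => by linarith [hr1 n])
  let T : ℕ → Type := fun n => {h : ℂ → ℂ // Continuous h ∧ ∀ z ∈ F ∪ closedBall 0 (r (n + 1)), h z ≠ 0}
  have hbase : ∃ h : T 0, EqOn h.1 f F := by
    obtain ⟨h', hc', he', hn'⟩ := extend_step hF hA1 (hrpos 1) hf h0
    refine ⟨⟨h', hc', ?_⟩, he'⟩
    rintro z (hz | hz)
    · rw [he' hz]; exact h0 z hz
    · exact hn' z hz
  have hstep : ∀ n, ∀ h : T n, ∃ h' : T (n + 1), EqOn h'.1 h.1 (F ∪ closedBall 0 (r n)) := by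
    rintro n ⟨h, hc, hn⟩
    obtain ⟨hE1, hE2⟩ := hull_facts (hF.union (isClosed_closedBall (x := (0:ℂ)) (ε := r n)))
    obtain ⟨h', hc', he', hn'⟩ := extend_step hE1 hE2 (hrpos (n + 1 + 1)) (h := h) hc.continuousOn (by
      rintro z ((hz | hz) | hz)
      · exact hn z (Or.inl hz)
      · exact hn z (Or.inr (closedBall_subset_closedBall (hrmono (Nat.le_succ n)) hz))
      · exact hn z (Or.inr (hρ2 _ hz)))
    refine ⟨⟨h', hc', ?_⟩, fun z hz => he' (Or.inl hz)⟩
    rintro z (hz | hz)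
    · rw [he' (Or.inl (Or.inl hz))]; exact hn z (Or.inl hz)
    · exact hn' z hz
  obtain ⟨b, hb⟩ := hbase
  choose st hst using hstep
  let s : ∀ n, T n := fun n => Nat.rec b (fun n h => st n h) n
  have hs : ∀ n, EqOn (s (n + 1)).1 (s n).1 (F ∪ closedBall 0 (r n)) := fun n => hst n (s n)
  have hs' : ∀ m n, m ≤ n → EqOn (s n).1 (s m).1 (F ∪ closedBall 0 (r m)) := by
    intro m n hmn
    induction n, hmn using Nat.le_induction with
    | base => exact fun _ _ => rfl
    | succ n hmn ih =>
      intro z hz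
      rw [hs n (union_subset_union_right F (closedBall_subset_closedBall (hrmono hmn)) hz), ih hz]
  have hNr : ∀ z : ℂ, ∀ n : ℕ, ‖z‖ ≤ n → z ∈ closedBall (0:ℂ) (r n) := by
    intro z n hz
    rw [mem_closedBall_zero_iff]
    linarith [hrn n]
  set fi : ℂ → ℂ := fun z => (s ⌈‖z‖⌉₊).1 z with hfi
  have hfin : ∀ n : ℕ, ∀ z, ‖z‖ ≤ n → fi z = (s n).1 z := by
    intro n z hz
    have h1 : ⌈‖z‖⌉₊ ≤ n := Nat.ceil_le.2 hz
    exact (hs' _ _ h1 (Or.inr (hNr z _ (Nat.le_ceil _)))).symm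
  have hfic : Continuous fi := by
    rw [continuous_iff_continuousAt]
    intro z
    obtain ⟨n, hn⟩ := exists_nat_gt ‖z‖
    have hev : fi =ᶠ[𝓝 z] (s n).1 := by
      filter_upwards [(isOpen_ball (x := (0:ℂ)) (ε := n)).mem_nhds (mem_ball_zero_iff.2 hn)] with w hw
      exact hfin n w (mem_ball_zero_iff.1 hw).le
    exact ((s n).2.1.continuousAt).congr hev.symm
  have hfi0 : ∀ z, fi z ≠ 0 := by
    intro z
    refine (s ⌈‖z‖⌉₊).2.2 z (Or.inr ?_)
    exact closedBall_subset_closedBall (hrmono (Nat.le_succ _)) (hNr z _ (Nat.le_ceil _))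
  have hfiF : ∀ z ∈ F, fi z = f z := by
    intro z hz
    have h1 := hs' 0 ⌈‖z‖⌉₊ (Nat.zero_le _) (Or.inl hz)
    exact h1.trans (hb hz)
  obtain ⟨g, hg, he⟩ := global_log hfic hfi0
  exact ⟨g, hg.continuousOn, fun z hz => by rw [he, hfiF z hz]⟩

lemma differentiableOn_of_exp {U : Set ℂ} (hU : IsOpen U) {f g : ℂ → ℂ} (hg : ContinuousOn g U)
    (hf : DifferentiableOn ℂ f U) (he : ∀ z ∈ U, Complex.exp (g z) = f z) :
    DifferentiableOn ℂ g U := by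
  intro z hz
  have hUz := hU.mem_nhds hz
  have hgz := hg.continuousAt hUz
  have hfz := hf.differentiableAt hUz
  have hfz0 : f z ≠ 0 := by rw [← he z hz]; exact Complex.exp_ne_zero _
  have hd : DifferentiableAt ℂ (fun w => g z + Complex.log (f w / f z)) z := by
    refine (differentiableAt_const _).add ((hfz.div_const (f z)).clog ?_)
    rw [div_self hfz0]; exact Complex.one_mem_slitPlane
  refine (hd.congr_of_eventuallyEq ?_).differentiableWithinAt
  have h1 : ∀ᶠ w in 𝓝 z, ‖g w - g z‖ < Real.pi := by
    have : Filter.Tendsto (fun w => ‖g w - g z‖) (𝓝 z) (𝓝 ‖g z - g z‖) :=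
      (hgz.sub continuousAt_const).norm
    refine this.eventually_lt_const ?_
    simpa using Real.pi_pos
  filter_upwards [h1, hUz] with w hw hwU
  rw [← he w hwU, ← he z hz, ← Complex.exp_sub]
  have h2 := abs_lt.1 (lt_of_le_of_lt (Complex.abs_im_le_norm (g w - g z)) hw)
  rw [Complex.log_exp h2.1 h2.2.le]
  ring

lemma const_of_exp_const {φ : ℝ → ℂ} (hφ : Continuous φ) {c : ℂ}
    (h : ∀ t, Complex.exp (φ t) = c) (s t : ℝ) : φ s = φ t := by
  have hl : IsLocallyConstant φ := by
    rw [IsLocallyConstant.iff_eventually_eq]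
    intro x
    have h1 : ∀ᶠ w in 𝓝 x, ‖φ w - φ x‖ < Real.pi := by
      have : Filter.Tendsto (fun w => ‖φ w - φ x‖) (𝓝 x) (𝓝 ‖φ x - φ x‖) :=
        ((hφ.sub continuous_const).norm).tendsto x
      refine this.eventually_lt_const ?_
      simpa using Real.pi_pos
    filter_upwards [h1] with w hw
    have h2 := abs_lt.1 (lt_of_le_of_lt (Complex.abs_im_le_norm (φ w - φ x)) hw)
    have h3 := Complex.log_exp h2.1 h2.2.le
    have hc : c ≠ 0 := by rw [← h x]; exact Complex.exp_ne_zero _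
    rw [Complex.exp_sub, h, h, div_self hc, Complex.log_one] at h3
    exact (sub_eq_zero.1 h3.symm)
  exact hl.apply_eq_of_preconnectedSpace s t

lemma no_log_frontier {G : Set ℂ} (hb : IsBounded G) {a : ℂ} (ha : a ∈ G)
    {k u : ℂ → ℂ} (hk : Continuous k) (hk0 : ∀ z ∈ closure G, k z ≠ 0)
    (hu : ContinuousOn u (frontier G))
    (he : ∀ z ∈ frontier G, Complex.exp (u z) = (z - a) * k z) : False := by
  obtain ⟨v, hv, hvu⟩ := tietze_ext isClosed_frontier hu
  classical
  set ψ : ℂ → ℂ := G.piecewise (fun z => Complex.exp (v z) / k z) (fun z => z - a) with hψ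
  have hin : ∀ z ∈ G, ψ z = Complex.exp (v z) / k z :=
    fun z hz => by simp only [hψ, Set.piecewise, hz, if_true]
  have hout : ∀ z, z ∉ G → ψ z = z - a :=
    fun z hz => by simp only [hψ, Set.piecewise, hz, if_false]
  have hψc : Continuous ψ := by
    refine continuous_piecewise ?_ ?_ ?_
    · intro z hz
      rw [hvu hz, he z hz, mul_div_cancel_right₀ _ (hk0 z (frontier_subset_closure hz))]
    · exact hv.cexp.continuousOn.div hk.continuousOn hk0
    · fun_prop
  have hψ0 : ∀ z, ψ z ≠ 0 := by
    intro z
    by_cases hz : z ∈ G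
    · rw [hin z hz]
      exact div_ne_zero (Complex.exp_ne_zero _) (hk0 z (subset_closure hz))
    · rw [hout z hz, sub_ne_zero]
      rintro rfl
      exact hz ha
  obtain ⟨w, hw, hwe⟩ := global_log hψc hψ0
  obtain ⟨M, hM⟩ := hb.subset_closedBall a
  set ρ : ℝ := |M| + 1
  have hρ : 0 < ρ := by positivity
  have hcirc : ∀ t : ℝ, Complex.exp (w (a + ρ * Complex.exp (t * Complex.I)) - t * Complex.I) = ρ := by
    intro t
    have hnot : a + ρ * Complex.exp (t * Complex.I) ∉ G := by
      intro h
      have := hM h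
      rw [mem_closedBall, dist_eq_norm, add_sub_cancel_left, norm_mul,
        Complex.norm_exp_ofReal_mul_I, Complex.norm_real, Real.norm_eq_abs, abs_of_pos hρ] at this
      have := le_abs_self M
      simp only [ρ] at *
      linarith
    rw [Complex.exp_sub, hwe, hout _ hnot, add_sub_cancel_left,
      mul_div_cancel_right₀ _ (Complex.exp_ne_zero _)]
  have h1 := const_of_exp_const (φ := fun t : ℝ =>
    w (a + ρ * Complex.exp (t * Complex.I)) - t * Complex.I) (by fun_prop) hcirc 0 (2 * Real.pi)
  simp only [Complex.ofReal_zero, zero_mul, Complex.exp_zero, Complex.ofReal_mul,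
    Complex.ofReal_ofNat, Complex.exp_two_pi_mul_I, sub_zero] at h1
  have h2 : (2 * (Real.pi : ℂ)) * Complex.I = 0 := by linear_combination h1
  exact Complex.two_pi_I_ne_zero h2

lemma frontier_component {O : Set ℂ} (hO : IsOpen O) (x : ℂ) :
    frontier (connectedComponentIn O x) ⊆ Oᶜ := by
  intro z hz hzO
  have hG : IsOpen (connectedComponentIn O x) := hO.connectedComponentIn
  rw [hG.frontier_eq] at hz
  have hz1 : IsOpen (connectedComponentIn O z) := hO.connectedComponentIn
  obtain ⟨y, hy1, hy2⟩ := mem_closure_iff.1 hz.1 _ hz1 (mem_connectedComponentIn hzO)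
  have e1 := connectedComponentIn_eq hy1
  have e2 := connectedComponentIn_eq hy2
  apply hz.2
  rw [e2, ← e1]
  exact mem_connectedComponentIn hzO

/-- canonical product of genus zero -/
noncomputable def canProd (c : ℕ → ℂ) (z : ℂ) : ℂ := ∏' m, (1 + c m * z)

lemma canProd_differentiable {c : ℕ → ℂ} (hc : Summable (fun m => ‖c m‖)) :
    Differentiable ℂ (canProd c) := by
  intro z
  set r : ℝ := ‖z‖ + 1
  have hz : z ∈ ball (0:ℂ) r := by rw [mem_ball_zero_iff]; simp [r]
  have h1 : HasProdLocallyUniformlyOn (fun m x => 1 + c m * x) (fun x => ∏' m, (1 + c m * x))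
      (ball (0:ℂ) r) := by
    refine Summable.hasProdLocallyUniformlyOn_nat_one_add isOpen_ball (hc.mul_right r)
      (Filter.Eventually.of_forall fun n x hx => ?_) (fun n => by fun_prop)
    rw [norm_mul]
    gcongr
    exact (mem_ball_zero_iff.1 hx).le
  have h2 : DifferentiableOn ℂ (fun x => ∏' m, (1 + c m * x)) (ball (0:ℂ) r) :=
    h1.differentiableOn (.of_forall fun _ => by
      simpa [Finset.prod_fn] using DifferentiableOn.finsetProd (fun _ _ => by fun_prop)) isOpen_ball
  exact h2.differentiableAt (isOpen_ball.mem_nhds hz)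

lemma canProd_ne_zero {c : ℕ → ℂ} (hc : Summable (fun m => ‖c m‖)) {z : ℂ}
    (h : ∀ m, 1 + c m * z ≠ 0) : canProd c z ≠ 0 := by
  refine tprod_one_add_ne_zero_of_summable h ?_
  simp only [norm_mul]
  exact hc.mul_right _

lemma canProd_split {c : ℕ → ℂ} (hc : Summable (fun m => ‖c m‖)) (n : ℕ) (z : ℂ) :
    canProd c z = (1 + c n * z) * canProd (Function.update c n 0) z := by
  have hc' : Summable (fun m => ‖Function.update c n 0 m‖) := by
    refine Summable.of_nonneg_of_le (fun _ => norm_nonneg _) (fun m => ?_) hc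
    by_cases h : m = n
    · subst h; simp
    · simp [Function.update_of_ne h]
  have hm : Multipliable (fun m => 1 + Function.update c n 0 m * z) := by
    refine multipliable_one_add_of_summable ?_
    simp only [norm_mul]
    exact hc'.mul_right _
  unfold canProd
  have h2 : HasProd (fun m => if m = n then (1 + c n * z) else 1) (1 + c n * z) :=
    hasProd_ite_eq n _
  have h3 := (h2.mul hm.hasProd).tprod_eq
  rw [← h3]
  congr 1
  ext m
  by_cases h : m = n
  · subst h; simp
  · simp [h]

lemma canProd_update_summable {c : ℕ → ℂ} (hc : Summable (fun m => ‖c m‖)) (n : ℕ) :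
    Summable (fun m => ‖Function.update c n 0 m‖) := by
  refine Summable.of_nonneg_of_le (fun _ => norm_nonneg _) (fun m => ?_) hc
  by_cases h : m = n
  · subst h; simp
  · simp [Function.update_of_ne h]

lemma exists_frontier_subset {F : Set ℂ} (hF : IsClosed F) {R : ℝ} (hR : 0 < R) {a : ℕ → ℂ}
    (ha : ∀ n, a n ∈ (F ∪ closedBall 0 R)ᶜ)
    (hd : ∀ i j, i < j → a j ∉ connectedComponentIn (F ∪ closedBall 0 R)ᶜ (a i))
    {W : Set ℂ} (hW : IsOpen W) (hFW : F ∩ closedBall 0 R ⊆ W) :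
    ∃ n, frontier (connectedComponentIn (F ∪ closedBall 0 R)ᶜ (a n)) ∩ closedBall 0 R ⊆ W := by
  by_contra! hcon
  set O : Set ℂ := (F ∪ closedBall 0 R)ᶜ with hO
  have hgt : ∀ n, connectedComponentIn O (a n) ⊆ {z : ℂ | R < ‖z‖} := by
    intro n z hz
    have := connectedComponentIn_subset _ _ hz
    simp only [hO, mem_compl_iff, mem_union, not_or, mem_closedBall, dist_zero_right, not_le]
      at this
    exact this.2
  have hex : ∀ n, ∃ z, z ∈ frontier (connectedComponentIn O (a n)) ∧ z ∈ closedBall (0:ℂ) R ∧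
      z ∉ W := by
    intro n
    obtain ⟨z, hz, hz'⟩ := not_subset.mp (hcon n)
    exact ⟨z, hz.1, hz.2, hz'⟩
  choose z hz1 hz2 hz3 using hex
  have hcomp : IsCompact (closedBall (0:ℂ) R \ W) := (isCompact_closedBall 0 R).diff hW
  obtain ⟨p, hp, φ, hφ, hlim⟩ := hcomp.tendsto_subseq (x := z) (fun n => ⟨hz2 n, hz3 n⟩)
  have hpF : p ∉ F := fun h => hp.2 (hFW ⟨h, hp.1⟩)
  have hzR : ∀ n, R ≤ ‖z n‖ := by
    intro n
    have hcl : IsClosed {z : ℂ | R ≤ ‖z‖} := isClosed_le continuous_const continuous_norm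
    have h1 : closure (connectedComponentIn O (a n)) ⊆ {z : ℂ | R ≤ ‖z‖} :=
      closure_minimal (fun w hw => le_of_lt (show R < ‖w‖ from hgt n hw)) hcl
    exact h1 (frontier_subset_closure (hz1 n))
  have hpR : R ≤ ‖p‖ :=
    ge_of_tendsto (hlim.norm) (Filter.Eventually.of_forall fun n => hzR (φ n))
  have hp0 : p ≠ 0 := norm_pos_iff.mp (lt_of_lt_of_le hR hpR)
  have hop : IsOpen (Complex.exp ⁻¹' Fᶜ) := hF.isOpen_compl.preimage Complex.continuous_exp
  have hmem : Complex.log p ∈ Complex.exp ⁻¹' Fᶜ := by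
    simp only [mem_preimage, Complex.exp_log hp0]; exact hpF
  obtain ⟨ε, hε, hball⟩ := Metric.isOpen_iff.mp hop _ hmem
  set N : Set ℂ := Complex.exp '' ball (Complex.log p) ε with hN
  set S : Set ℂ := Complex.exp '' (ball (Complex.log p) ε ∩ {w | Real.log R < w.re}) with hS
  have hNo : IsOpen N := Complex.isOpenMap_exp _ isOpen_ball
  have hpN : p ∈ N := ⟨Complex.log p, mem_ball_self hε, Complex.exp_log hp0⟩
  have hSpre : IsPreconnected S := by
    apply IsPreconnected.image _ _ Complex.continuous_exp.continuousOn
    exact ((convex_ball _ _).inter (convex_halfSpace_re_gt _)).isPreconnected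
  have hSO : S ⊆ O := by
    rintro _ ⟨w, ⟨hw1, hw2⟩, rfl⟩
    simp only [hO, mem_compl_iff, mem_union, not_or, mem_closedBall, dist_zero_right, not_le]
    refine ⟨hball hw1, ?_⟩
    rw [Complex.norm_exp]
    exact (Real.log_lt_iff_lt_exp hR).mp hw2
  have hev : ∀ᶠ i in Filter.atTop, z (φ i) ∈ N := hlim.eventually (hNo.mem_nhds hpN)
  have key : ∀ i, z i ∈ N → ∃ y ∈ S, y ∈ connectedComponentIn O (a i) := by
    intro i hi
    obtain ⟨y, hy1, hy2⟩ := mem_closure_iff.mp (frontier_subset_closure (hz1 i)) N hNo hi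
    obtain ⟨w, hw, rfl⟩ := hy1
    refine ⟨_, ⟨w, ⟨hw, ?_⟩, rfl⟩, hy2⟩
    have := hgt i hy2
    simp only [mem_ofPred_eq, Complex.norm_exp] at this
    exact (Real.log_lt_iff_lt_exp hR).mpr this
  obtain ⟨i0, hi0⟩ := Filter.eventually_atTop.mp hev
  obtain ⟨y, hyS, hyi⟩ := key _ (hi0 i0 le_rfl)
  obtain ⟨y', hyS', hyj⟩ := key _ (hi0 (i0+1) (Nat.le_succ _))
  apply hd _ _ (hφ (Nat.lt_succ_self i0))
  have e1 := connectedComponentIn_eq hyi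
  have e2 := connectedComponentIn_eq hyj
  have h3 : y' ∈ connectedComponentIn O y := hSpre.subset_connectedComponentIn hyS hSO hyS'
  have e3 := connectedComponentIn_eq h3
  rw [e1, e3, ← e2]
  exact mem_connectedComponentIn (ha _)

lemma exists_seq_unbounded {O : Set ℂ}
    (hub : ¬ IsBounded {z : ℂ | z ∈ O ∧ IsBounded (connectedComponentIn O z)}) :
    ∃ a : ℕ → ℂ, (∀ n, a n ∈ O) ∧ (∀ n, IsBounded (connectedComponentIn O (a n))) ∧
      (∀ n, (2:ℝ) ^ n ≤ ‖a n‖) ∧ ∀ i j, i < j → a j ∉ connectedComponentIn O (a i) := by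
  have hex : ∀ M : ℝ, ∃ z : ℂ, (z ∈ O ∧ IsBounded (connectedComponentIn O z)) ∧ M < ‖z‖ := by
    intro M
    by_contra! h
    exact hub (isBounded_iff_forall_norm_le.mpr ⟨M, fun x hx => h x hx⟩)
  choose pick hp1 hp2 using hex
  have hβ : ∀ M : ℝ, ∃ β : ℝ, ∀ z ∈ connectedComponentIn O (pick M), ‖z‖ ≤ β :=
    fun M => isBounded_iff_forall_norm_le.mp (hp1 M).2
  choose β hβ using hβ
  let M : ℕ → ℝ := fun n => Nat.rec 1 (fun _ x => max (2 * x) (β x)) n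
  have hM1 : ∀ n, M (n+1) = max (2 * M n) (β (M n)) := fun n => rfl
  have hMp : ∀ n, (2:ℝ)^n ≤ M n := by
    intro n
    induction n with
    | zero => simp [M]
    | succ n ih => rw [hM1, pow_succ]; exact le_max_of_le_left (by linarith)
  have hmono : Monotone M := by
    apply monotone_nat_of_le_succ
    intro n
    rw [hM1]
    have : (0:ℝ) < 2 ^ n := by positivity
    exact le_max_of_le_left (by linarith [hMp n])
  refine ⟨fun n => pick (M n), fun n => (hp1 _).1, fun n => (hp1 _).2,
    fun n => (hMp n).trans (hp2 _).le, fun i j hij hmem => ?_⟩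
  have h1 := hβ _ _ hmem
  have h2 : β (M i) ≤ M (i+1) := by rw [hM1]; exact le_max_right _ _
  have h3 : M (i+1) ≤ M j := hmono hij
  have h4 := hp2 (M j)
  linarith

lemma log_imp_arakelian {F : Set ℂ} (hF : IsClosed F)
    (hP : ∀ f : ℂ → ℂ, Differentiable ℂ f → (∀ z ∈ F, f z ≠ 0) → HasLogOn f F) :
    IsArakelian F := by
  constructor
  · intro a ha hb
    obtain ⟨g, hg, he⟩ := hP (fun z => z - a) (by fun_prop)
      (fun z hz h => ha (by rw [← sub_eq_zero.mp h]; exact hz))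
    have hfr : frontier (connectedComponentIn Fᶜ a) ⊆ F := by
      simpa using frontier_component hF.isOpen_compl a
    exact no_log_frontier (k := fun _ => 1) hb (mem_connectedComponentIn ha) continuous_const
      (fun _ _ => one_ne_zero) (hg.mono hfr) (fun z hz => by simpa using he z (hfr hz))
  intro K hK
  by_contra hub
  obtain ⟨R0, hR0⟩ := hK.isBounded.subset_closedBall (0:ℂ)
  set R : ℝ := max R0 1 with hRdef
  have hR : 0 < R := lt_of_lt_of_le one_pos (le_max_right _ _)
  have hKR : K ⊆ closedBall 0 R := hR0.trans (closedBall_subset_closedBall (le_max_left _ _))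
  set O : Set ℂ := (F ∪ closedBall 0 R)ᶜ with hO
  have hOo : IsOpen O := (hF.union isClosed_closedBall).isOpen_compl
  have hOs : O ⊆ (F ∪ K)ᶜ := compl_subset_compl.mpr (union_subset_union_right _ hKR)
  have hub' : ¬ IsBounded {z : ℂ | z ∈ O ∧ IsBounded (connectedComponentIn O z)} := by
    intro hb
    apply hub
    apply (hb.union (isBounded_closedBall (x := (0:ℂ)) (r := R))).subset
    rintro z ⟨hz1, hz2⟩
    by_cases hz : z ∈ closedBall (0:ℂ) R
    · exact Or.inr hz
    · refine Or.inl ⟨?_, hz2.subset (connectedComponentIn_mono z hOs)⟩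
      rintro (h | h)
      · exact hz1 (Or.inl h)
      · exact hz h
  obtain ⟨a, haO, hab, han, had⟩ := exists_seq_unbounded hub'
  have had' : ∀ i j, i ≠ j → a j ∉ connectedComponentIn O (a i) := by
    intro i j hij hmem
    rcases lt_or_gt_of_ne hij with h | h
    · exact had _ _ h hmem
    · apply had _ _ h
      rw [← connectedComponentIn_eq hmem]
      exact mem_connectedComponentIn (haO i)
  have ha0 : ∀ n, a n ≠ 0 := fun n =>
    norm_pos_iff.mp (lt_of_lt_of_le (by positivity) (han n))
  set c : ℕ → ℂ := fun n => -(a n)⁻¹ with hc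
  have hcz : ∀ n z, 1 + c n * z = (z - a n) * c n := by
    intro n z
    have := ha0 n
    simp only [hc]
    field_simp
    ring
  have hc0 : ∀ n, c n ≠ 0 := fun n => neg_ne_zero.mpr (inv_ne_zero (ha0 n))
  have hcs : Summable fun m => ‖c m‖ := by
    apply Summable.of_nonneg_of_le (fun _ => norm_nonneg _) (fun n => ?_)
      (summable_geometric_of_lt_one (r := (1/2:ℝ)) (by norm_num) (by norm_num))
    simp only [hc, norm_neg, norm_inv, one_div, inv_pow]
    exact inv_anti₀ (by positivity) (han n)
  set f := canProd c with hf
  have hfd : Differentiable ℂ f := canProd_differentiable hcs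
  have hf0 : ∀ z ∈ F ∪ closedBall 0 R, f z ≠ 0 := by
    intro z hz
    apply canProd_ne_zero hcs
    intro m
    rw [hcz]
    refine mul_ne_zero (fun h => haO m ?_) (hc0 m)
    rw [← sub_eq_zero.mp h]; exact hz
  obtain ⟨g, hg, hge⟩ := hP f hfd (fun z hz => hf0 z (Or.inl hz))
  obtain ⟨h, hh, hhe⟩ := hasLogOn_closedBall hR hfd.continuous.continuousOn
    (fun z hz => hf0 z (Or.inr hz))
  obtain ⟨δ, hδ, hδe⟩ := tietze_ext (hF.inter (isClosed_closedBall (x := (0:ℂ)) (ε := R)))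
    (f := fun z => g z - h z) ((hg.mono inter_subset_left).sub (hh.mono inter_subset_right))
  have hδ1 : ∀ z ∈ F ∩ closedBall 0 R, Complex.exp (δ z) = 1 := by
    intro z hz
    rw [hδe hz, Complex.exp_sub, hge z hz.1, hhe z hz.2]
    exact div_self (hf0 z (Or.inl hz.1))
  set W : Set ℂ := {z | 0 < (Complex.exp (δ z)).re} with hW
  have hWo : IsOpen W := isOpen_lt continuous_const (by fun_prop)
  have hFW : F ∩ closedBall 0 R ⊆ W := by
    intro z hz
    simp only [hW, mem_ofPred_eq, hδ1 z hz, Complex.one_re]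
    exact one_pos
  obtain ⟨n, hn⟩ := exists_frontier_subset hF hR haO had hWo hFW
  set G := connectedComponentIn O (a n) with hG
  have hfr : frontier G ⊆ F ∪ closedBall 0 R := by
    have h1 := frontier_component hOo (a n)
    rwa [hO, compl_compl] at h1
  set h' : ℂ → ℂ := fun z => h z + δ z - Complex.log (Complex.exp (δ z)) with hh'
  have hh'c : ContinuousOn h' (closedBall 0 R ∩ W) := by
    apply ((hh.mono inter_subset_left).add hδ.continuousOn).sub
    apply ContinuousOn.clog (by fun_prop)
    intro z hz
    exact Or.inl hz.2
  have hh'e : ∀ z ∈ closedBall (0:ℂ) R, Complex.exp (h' z) = f z := by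
    intro z hz
    simp only [hh', Complex.exp_sub, Complex.exp_add, Complex.exp_log (Complex.exp_ne_zero _),
      hhe z hz]
    field_simp
  have hh'g : ∀ z ∈ F ∩ closedBall 0 R, h' z = g z := by
    intro z hz
    simp only [hh']
    rw [hδ1 z hz, Complex.log_one, hδe hz]
    ring
  classical
  set u : ℂ → ℂ := F.piecewise g h' with hu
  have hu1 : EqOn u g F := piecewise_eqOn F g h'
  have hu2 : EqOn u h' (closedBall 0 R) := by
    intro z hz
    by_cases hzF : z ∈ F
    · rw [hu1 hzF, hh'g z ⟨hzF, hz⟩]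
    · exact piecewise_eq_of_notMem F g h' hzF
  have huc : ContinuousOn u (frontier G) := by
    have e : frontier G = (frontier G ∩ F) ∪ (frontier G ∩ closedBall 0 R) := by
      rw [← inter_union_distrib_left, inter_eq_left.mpr hfr]
    rw [e]
    apply ContinuousOn.union_of_isClosed
    · exact (hg.mono inter_subset_right).congr (hu1.mono inter_subset_right)
    · exact (hh'c.mono (fun z hz => ⟨hz.2, hn hz⟩)).congr (hu2.mono inter_subset_right)
    · exact isClosed_frontier.inter hF
    · exact isClosed_frontier.inter isClosed_closedBall
  have hue : ∀ z ∈ F ∪ closedBall 0 R, Complex.exp (u z) = f z := by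
    rintro z (hz | hz)
    · rw [hu1 hz, hge z hz]
    · rw [hu2 hz, hh'e z hz]
  have hcs' := canProd_update_summable hcs n
  refine no_log_frontier (k := fun z => c n * canProd (Function.update c n 0) z) (hab n)
    (mem_connectedComponentIn (haO n))
    (continuous_const.mul (canProd_differentiable hcs').continuous) ?_ huc ?_
  · intro z hz
    refine mul_ne_zero (hc0 n) (canProd_ne_zero hcs' fun m => ?_)
    by_cases hmn : m = n
    · subst hmn; simp
    rw [Function.update_of_ne hmn, hcz]
    refine mul_ne_zero (fun hzm => ?_) (hc0 m)
    rw [sub_eq_zero.mp hzm] at hz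
    rw [closure_eq_self_union_frontier] at hz
    rcases hz with hz | hz
    · exact had' n m (Ne.symm hmn) hz
    · exact haO m (hfr hz)
  · intro z hz
    rw [hue z (hfr hz), hf, canProd_split hcs n z, hcz]
    ring

end Aux

theorem arakelian_iff_log (F : Set ℂ) (hF : IsClosed F) :
    IsArakelian F ↔
      ∀ f : ℂ → ℂ, ContinuousOn f F → DifferentiableOn ℂ f (interior F) →
        (∀ z ∈ F, f z ≠ 0) →
        ∃ g : ℂ → ℂ, ContinuousOn g F ∧ DifferentiableOn ℂ g (interior F) ∧
          ∀ z ∈ F, Complex.exp (g z) = f z := by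
  constructor
  · intro hA f hf hfd h0
    obtain ⟨g, hg, he⟩ := arakelian_log hF hA hf h0
    exact ⟨g, hg, differentiableOn_of_exp isOpen_interior (hg.mono interior_subset) hfd
      (fun z hz => he z (interior_subset hz)), he⟩
  · intro hP
    refine log_imp_arakelian hF fun f hf h0 => ?_
    obtain ⟨g, hg, -, he⟩ := hP f hf.continuous.continuousOn hf.differentiableOn h0
    exact ⟨g, hg, he⟩
end

section
/- Let F ⊆ ℂ be a closed set with the property that for every function f : ℂ → ℂ that is continuous on F, holomorphic on the interior of F, and has no zeros on F, there exists a function g : ℂ → ℂ, continuous on F and holomorphic on the interior of F, with exp(g(z)) = f(z) for all z ∈ F. Then F is an Arakelian set. -/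
open Complex Metric Bornology

/-- Tietze extension for a complex function continuous on a closed set. -/
lemma exists_cont_ext (s : Set ℂ) (hs : IsClosed s) (G : ℂ → ℂ) (hG : ContinuousOn G s) :
    ∃ H : ℂ → ℂ, Continuous H ∧ ∀ z ∈ s, H z = G z := by
  obtain ⟨g, hg⟩ := ContinuousMap.exists_restrict_eq hs
    (⟨s.domRestrict G, continuousOn_iff_continuous_domRestrict.1 hG⟩ : C(s, ℂ))
  refine ⟨g, g.continuous, fun z hz => ?_⟩
  have := congrArg (fun k : C(s, ℂ) => k ⟨z, hz⟩) hg
  exact this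

/-- A continuous nowhere vanishing function on the plane has a continuous logarithm. -/
lemma exists_cont_log (ψ : ℂ → ℂ) (hψ : Continuous ψ) (h0 : ∀ z, ψ z ≠ 0) :
    ∃ L : ℂ → ℂ, Continuous L ∧ ∀ z, exp (L z) = ψ z := by
  obtain ⟨L, ⟨-, hL⟩, -⟩ := Complex.isCoveringMapOn_exp.existsUnique_continuousMap_lifts
    (⟨ψ, hψ⟩ : C(ℂ, ℂ)) (a₀ := 0) (e₀ := log (ψ 0)) (by simp [exp_log (h0 0)])
    (by intro a; simpa using h0 a)
  exact ⟨L, L.continuous, fun z => congrFun hL z⟩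

/-- There is no continuous logarithm of `z - a` on a circle around `a`. -/
lemma no_log_circle (a : ℂ) (R : ℝ) (L : ℂ → ℂ) (hL : Continuous L)
    (h : ∀ z, ‖z - a‖ = R → exp (L z) = z - a) (hR : 0 < R) : False := by
  let γ : ℝ → ℂ := fun t => a + R * exp (t * I)
  have hγ : Continuous γ := by fun_prop
  have hγn : ∀ t, ‖γ t - a‖ = R := by
    intro t
    simp [γ, norm_exp_ofReal_mul_I, abs_of_pos hR]
  have e1 : ∀ t, exp (L (γ t)) = R * exp (t * I) := by
    intro t; rw [h _ (hγn t)]; simp [γ]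
  have key := Complex.isCoveringMap_exp.eq_of_comp_eq (A := ℝ)
    (g₁ := fun t => L (γ t)) (g₂ := fun t => L (γ 0) + t * I) (by fun_prop) (by fun_prop)
    (by
      funext t
      apply Subtype.ext
      simp only [Function.comp]
      rw [exp_add, e1, e1]; simp) 0 (by simp)
  have h2 := congrFun key (2 * Real.pi)
  have h3 : γ (2 * Real.pi) = γ 0 := by
    simp only [γ]; push_cast; rw [exp_two_pi_mul_I]; simp
  simp only [h3] at h2
  have h4 : ((2 * Real.pi : ℝ) : ℂ) * I = 0 := by
    have := h2.symm
    simpa using this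
  simp [Real.pi_ne_zero] at h4

lemma no_log_frontier_s2 (U : Set ℂ) (hb : IsBounded U) (a : ℂ) (ha : a ∈ U)
    (p : ℂ → ℂ) (hp : ContinuousOn p (closure U)) (hp0 : ∀ z ∈ closure U, p z ≠ 0)
    (hU : IsOpen U)
    (G : ℂ → ℂ) (hG : ContinuousOn G (frontier U))
    (h : ∀ z ∈ frontier U, exp (G z) = (z - a) * p z) : False := by
  classical
  obtain ⟨H, hH, hHG⟩ := exists_cont_ext _ isClosed_frontier G hG
  let χ : ℂ → ℂ := U.piecewise (fun z => exp (H z) / p z) (fun z => z - a)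
  have hχ : Continuous χ := by
    apply continuous_piecewise
    · intro z hz
      rw [hHG z hz, h z hz, mul_div_cancel_right₀]
      exact hp0 z (frontier_subset_closure hz)
    · exact ContinuousOn.div (by fun_prop) hp hp0
    · fun_prop
  have hχ0 : ∀ z, χ z ≠ 0 := by
    intro z
    by_cases hz : z ∈ U
    · simp only [χ, Set.piecewise_eq_of_mem _ _ _ hz]
      exact div_ne_zero (exp_ne_zero _) (hp0 z (subset_closure hz))
    · simp only [χ, Set.piecewise_eq_of_notMem _ _ _ hz]
      intro h0
      rw [sub_eq_zero] at h0
      exact hz (h0 ▸ ha)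
  obtain ⟨L, hL, hLe⟩ := exists_cont_log χ hχ hχ0
  obtain ⟨R, hR⟩ := hb.subset_ball a
  have hRpos : 0 < R := by
    have := hR ha
    simpa using this
  refine no_log_circle a R L hL (fun z hz => ?_) hRpos
  have hzU : z ∉ U := by
    intro hzU
    have := hR hzU
    rw [mem_ball, dist_eq_norm] at this
    linarith
  rw [hLe]
  simp only [χ, Set.piecewise_eq_of_notMem _ _ _ hzU]

lemma frontier_comp (W : Set ℂ) (hW : IsOpen W) (x : ℂ) :
    frontier (connectedComponentIn W x) ⊆ Wᶜ := by
  intro z hz hzW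
  have ho : IsOpen (connectedComponentIn W x) := hW.connectedComponentIn
  rw [ho.frontier_eq] at hz
  have hz' : IsOpen (connectedComponentIn W z) := hW.connectedComponentIn
  obtain ⟨y, hy1, hy2⟩ := mem_closure_iff.1 hz.1 _ hz' (mem_connectedComponentIn hzW)
  have h1 := connectedComponentIn_eq hy1
  have h2 := connectedComponentIn_eq hy2
  apply hz.2
  rw [h2, ← h1]
  exact mem_connectedComponentIn hzW

/-- The product `∏ (1 + c m z)`. -/
noncomputable def prodFn (c : ℕ → ℂ) (z : ℂ) : ℂ := ∏' m, (1 + c m * z)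

lemma prodFn_diff (c : ℕ → ℂ) (hc : Summable fun m => ‖c m‖) : Differentiable ℂ (prodFn c) := by
  intro z
  have hK : IsOpen (ball (0:ℂ) (‖z‖ + 1)) := isOpen_ball
  have h := Summable.hasProdLocallyUniformlyOn_nat_one_add (f := fun m z => c m * z)
    (u := fun m => ‖c m‖ * (‖z‖ + 1)) hK (hc.mul_right _)
    (by
      refine Filter.Eventually.of_forall fun n x hx => ?_
      rw [norm_mul]
      have : ‖x‖ < ‖z‖ + 1 := by simpa using hx
      gcongr) (fun n => by fun_prop)
  have hd : DifferentiableOn ℂ (prodFn c) (ball (0:ℂ) (‖z‖ + 1)) := by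
    refine TendstoLocallyUniformlyOn.differentiableOn
      (hasProdLocallyUniformlyOn_iff_tendstoLocallyUniformlyOn.1 h) ?_ hK
    refine Filter.Eventually.of_forall fun n => ?_
    fun_prop
  exact hd.differentiableAt (hK.mem_nhds (by simp))

lemma prodFn_ne_zero (c : ℕ → ℂ) (hc : Summable fun m => ‖c m‖) (z : ℂ)
    (h : ∀ m, 1 + c m * z ≠ 0) : prodFn c z ≠ 0 := by
  refine tprod_one_add_ne_zero_of_summable h ?_
  simpa [norm_mul] using hc.mul_right ‖z‖

lemma summable_update (c : ℕ → ℂ) (hc : Summable fun m => ‖c m‖) (n : ℕ) :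
    Summable fun m => ‖Function.update c n 0 m‖ := by
  refine Summable.of_nonneg_of_le (fun _ => norm_nonneg _) (fun m => ?_) hc
  by_cases h : m = n
  · subst h; simp
  · simp [h]

lemma prodFn_factor (c : ℕ → ℂ) (hc : Summable fun m => ‖c m‖) (n : ℕ) (z : ℂ) :
    prodFn c z = (1 + c n * z) * prodFn (Function.update c n 0) z := by
  have hm : Multipliable (fun m => 1 + Function.update c n 0 m * z) := by
    refine multipliable_one_add_of_summable ?_
    simpa [norm_mul] using (summable_update c hc n).mul_right ‖z‖
  unfold prodFn
  have e : (Function.update (fun m => 1 + c m * z) n 1)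
      = fun m => 1 + Function.update c n 0 m * z := by
    funext m
    by_cases h : m = n
    · subst h; simp
    · simp [h]
  rw [Multipliable.tprod_eq_mul_tprod_ite' n (by rw [e]; exact hm)]
  congr 1
  refine tprod_congr fun m => ?_
  by_cases h : m = n
  · subst h; simp
  · simp [h]

/-- Locally at a point of the circle off `F`, the outside of the disc lies in one component. -/
lemma local_one (F : Set ℂ) (hF : IsClosed F) (R : ℝ) (hR : 0 < R) (z : ℂ) (hz : ‖z‖ = R)
    (hzF : z ∉ F) : ∃ V : Set ℂ, IsOpen V ∧ z ∈ V ∧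
      IsPreconnected (V \ closedBall 0 R) ∧ V ⊆ Fᶜ := by
  have hz0 : z ≠ 0 := by
    rintro rfl; simp at hz; linarith
  have hpre : exp ⁻¹' Fᶜ ∈ nhds (log z) := by
    apply continuous_exp.continuousAt.preimage_mem_nhds
    rw [exp_log hz0]
    exact hF.isOpen_compl.mem_nhds hzF
  obtain ⟨ε, hε, hb⟩ := Metric.mem_nhds_iff.1 hpre
  refine ⟨exp '' ball (log z) ε, Complex.isOpenMap_exp _ isOpen_ball,
    ⟨log z, mem_ball_self hε, exp_log hz0⟩, ?_, ?_⟩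
  · have : exp '' ball (log z) ε \ closedBall 0 R
        = exp '' (ball (log z) ε ∩ {w | Real.log R < w.re}) := by
      ext w
      constructor
      · rintro ⟨⟨u, hu, rfl⟩, hw⟩
        refine ⟨u, ⟨hu, ?_⟩, rfl⟩
        simp only [mem_closedBall, dist_zero_right, norm_exp, not_le] at hw
        exact (Real.log_lt_iff_lt_exp hR).2 hw
      · rintro ⟨u, ⟨hu, hu2⟩, rfl⟩
        refine ⟨⟨u, hu, rfl⟩, ?_⟩
        simp only [mem_closedBall, dist_zero_right, norm_exp, not_le]
        exact (Real.log_lt_iff_lt_exp hR).1 hu2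
    rw [this]
    refine IsPreconnected.image ?_ _ continuous_exp.continuousOn
    exact ((convex_ball _ _).inter (convex_halfSpace_re_gt _)).isPreconnected
  · rintro _ ⟨u, hu, rfl⟩
    exact hb hu

lemma exists_seq (S : Set ℂ) (hS : ¬ IsBounded S) (B : ℂ → ℝ) :
    ∃ a : ℕ → ℂ, (∀ n, a n ∈ S) ∧ (∀ n, 1 ≤ ‖a n‖) ∧ (∀ n, 2 * ‖a n‖ ≤ ‖a (n+1)‖) ∧
      ∀ n, B (a n) < ‖a (n+1)‖ := by
  have h : ∀ r : ℝ, ∃ x ∈ S, r < ‖x‖ := by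
    intro r
    by_contra hcon
    push Not at hcon
    exact hS ((isBounded_iff_forall_norm_le).2 ⟨r, hcon⟩)
  choose φ h1 h2 using h
  let step : ℂ → ℂ := fun x => φ (max 1 (max (2 * ‖x‖) (B x)))
  let a : ℕ → ℂ := fun n => step^[n] (φ 1)
  have hs : ∀ n, a (n+1) = step (a n) := fun n => Function.iterate_succ_apply' _ _ _
  have hh : ∀ n, max 1 (max (2 * ‖a n‖) (B (a n))) < ‖a (n+1)‖ := by
    intro n; rw [hs]; exact h2 _
  refine ⟨a, ?_, ?_, ?_, ?_⟩
  · rintro (_ | n)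
    · exact h1 _
    · rw [hs]; exact h1 _
  · rintro (_ | n)
    · exact (h2 _).le
    · exact (lt_of_le_of_lt (le_max_left _ _) (hh n)).le
  · intro n
    exact (lt_of_le_of_lt ((le_max_left _ _).trans (le_max_right _ _)) (hh n)).le
  · intro n
    exact (lt_of_le_of_lt ((le_max_right _ _).trans (le_max_right _ _)) (hh n))

lemma disc_case (F : Set ℂ) (hF : IsClosed F)
    (hlog : ∀ f : ℂ → ℂ, ContinuousOn f F → DifferentiableOn ℂ f (interior F) →
      (∀ z ∈ F, f z ≠ 0) →
      ∃ g : ℂ → ℂ, ContinuousOn g F ∧ DifferentiableOn ℂ g (interior F) ∧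
        ∀ z ∈ F, Complex.exp (g z) = f z) (R : ℝ) (hR : 0 < R) :
    IsBounded {z : ℂ | z ∈ (F ∪ closedBall 0 R)ᶜ ∧
      IsBounded (connectedComponentIn (F ∪ closedBall 0 R)ᶜ z)} := by
  by_contra hS
  set D : Set ℂ := closedBall 0 R with hD
  set W : Set ℂ := (F ∪ D)ᶜ with hWdef
  have hW : IsOpen W := (hF.union isClosed_closedBall).isOpen_compl
  have hB : ∀ x : ℂ, ∃ r : ℝ, IsBounded (connectedComponentIn W x) →
      ∀ y ∈ closure (connectedComponentIn W x), ‖y‖ ≤ r := by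
    intro x
    by_cases hx : IsBounded (connectedComponentIn W x)
    · obtain ⟨r, hr⟩ := isBounded_iff_forall_norm_le.1 hx.closure
      exact ⟨r, fun _ => hr⟩
    · exact ⟨0, fun h => absurd h hx⟩
  choose B hB using hB
  obtain ⟨a, haS, ha1, ha2, haB⟩ := exists_seq _ hS B
  have haW : ∀ n, a n ∈ W := fun n => (haS n).1
  set U : ℕ → Set ℂ := fun n => connectedComponentIn W (a n) with hU
  have hUo : ∀ n, IsOpen (U n) := fun n => hW.connectedComponentIn
  have hUb : ∀ n, IsBounded (U n) := fun n => (haS n).2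
  have haU : ∀ n, a n ∈ U n := fun n => mem_connectedComponentIn (haW n)
  have hfr : ∀ n, frontier (U n) ⊆ F ∪ D := by
    intro n
    have := frontier_comp W hW (a n)
    rwa [hWdef, compl_compl] at this
  have hmono : Monotone fun n => ‖a n‖ :=
    monotone_nat_of_le_succ fun n => by linarith [ha2 n, norm_nonneg (a n)]
  have hlt : ∀ n m, n < m → a m ∉ closure (U n) := by
    intro n m hnm hmem
    have h1 := hB (a n) (hUb n) _ hmem
    have h2 := haB n
    have h3 : ‖a (n+1)‖ ≤ ‖a m‖ := hmono hnm
    linarith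
  have hUeq : ∀ n m, (U n ∩ U m).Nonempty → U n = U m := by
    rintro n m ⟨y, hy1, hy2⟩
    exact (connectedComponentIn_eq hy1).trans (connectedComponentIn_eq hy2).symm
  have hinj : ∀ n m, (U n ∩ U m).Nonempty → n = m := by
    intro n m h
    have he := hUeq n m h
    rcases lt_trichotomy n m with hl | hl | hl
    · exact absurd (subset_closure (he ▸ haU m)) (hlt n m hl)
    · exact hl
    · exact absurd (subset_closure (he ▸ haU n)) (hlt m n hl)
  have hne : ∀ n m, m ≠ n → a m ∉ closure (U n) := by
    intro n m hmn hmem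
    by_cases hm : a m ∈ U n
    · exact hmn (hinj m n ⟨a m, haU m, hm⟩)
    · have : a m ∈ frontier (U n) := by
        rw [(hUo n).frontier_eq]; exact ⟨hmem, hm⟩
      exact haW m (hfr n this)
  have ha0 : ∀ n, a n ≠ 0 := fun n h => by
    have := ha1 n
    rw [h, norm_zero] at this
    linarith
  have hpow : ∀ n, (2:ℝ)^n ≤ ‖a n‖ := by
    intro n
    induction n with
    | zero => simpa using ha1 0
    | succ k ih => rw [pow_succ]; linarith [ha2 k]
  set c : ℕ → ℂ := fun n => -(a n)⁻¹ with hc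
  have hcs : Summable fun m => ‖c m‖ := by
    refine Summable.of_nonneg_of_le (fun _ => norm_nonneg _) (fun m => ?_)
      (summable_geometric_of_lt_one (r := (1/2 : ℝ)) (by norm_num) (by norm_num))
    simp only [c, norm_neg, norm_inv, one_div, inv_pow]
    exact inv_anti₀ (by positivity) (hpow m)
  have hcz : ∀ m z, z ≠ a m → 1 + c m * z ≠ 0 := by
    intro m z hz h
    apply hz
    have h1 := ha0 m
    simp only [c] at h
    field_simp at h
    linear_combination -h
  set f := prodFn c with hf
  have hfd : Differentiable ℂ f := prodFn_diff c hcs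
  have hfF : ∀ z ∈ F, f z ≠ 0 := fun z hz => prodFn_ne_zero c hcs z fun m =>
    hcz m z (by rintro rfl; exact haW m (Or.inl hz))
  obtain ⟨g, hg, -, hge⟩ := hlog f hfd.continuous.continuousOn hfd.differentiableOn hfF
  obtain ⟨G, hG, hGg⟩ := exists_cont_ext F hF g hg
  set h : ℂ → ℂ := fun z => f z * exp (-G z) with hh
  have hhc : Continuous h := by
    have := hfd.continuous
    fun_prop
  have hhF : ∀ z ∈ F, h z = 1 := by
    intro z hz
    simp only [h]
    rw [← hge z hz, hGg z hz, ← exp_add]; simp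
  -- some component has `h` close to `1` on its boundary
  have hex : ∃ n, ∀ z ∈ frontier (U n), ‖h z - 1‖ < 1 := by
    by_contra hcon
    push Not at hcon
    choose z hz hz1 using hcon
    have hzF : ∀ w, 1 ≤ ‖h w - 1‖ → w ∉ F := by
      intro w hw hwF
      rw [hhF w hwF] at hw
      norm_num at hw
    have hzD : ∀ n, z n ∈ D := fun n => (hfr n (hz n)).resolve_left (hzF _ (hz1 n))
    have hzs : ∀ n, z n ∈ sphere (0:ℂ) R := by
      intro n
      have h1 : ‖z n‖ ≤ R := by simpa [D] using hzD n
      rcases h1.lt_or_eq with h2 | h2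
      · exfalso
        obtain ⟨y, hy1, hy2⟩ := mem_closure_iff.1 (frontier_subset_closure (hz n)) (ball 0 R)
          isOpen_ball (by simpa using h2)
        exact connectedComponentIn_subset W (a n) hy2 (Or.inr (ball_subset_closedBall hy1))
      · simpa using h2
    obtain ⟨w, hw, φ, hφ, hlim⟩ := (isCompact_sphere (0:ℂ) R).tendsto_subseq hzs
    have hw1 : 1 ≤ ‖h w - 1‖ := by
      refine ge_of_tendsto' (((hhc.sub continuous_const).norm.tendsto w).comp hlim) fun n => ?_
      exact hz1 _
    obtain ⟨V, hVo, hwV, hVc, hVF⟩ := local_one F hF R hR w (by simpa using hw) (hzF w hw1)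
    have hsub : ∀ n, z n ∈ V → V \ D ⊆ U n ∧ (V \ D).Nonempty := by
      intro n hn
      obtain ⟨y, hy1, hy2⟩ := mem_closure_iff.1 (frontier_subset_closure (hz n)) V hVo hn
      have hyD : y ∉ D := fun hyD => connectedComponentIn_subset W (a n) hy2 (Or.inr hyD)
      refine ⟨?_, y, hy1, hyD⟩
      have := hVc.subset_connectedComponentIn (x := y) (F := W) ⟨hy1, hyD⟩ (by
        rintro x ⟨hx1, hx2⟩ (hx | hx)
        · exact hVF hx1 hx
        · exact hx2 hx)
      rwa [← connectedComponentIn_eq hy2] at this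
    obtain ⟨N, hN⟩ := Filter.eventually_atTop.1 (hlim.eventually (hVo.mem_nhds hwV))
    obtain ⟨s1, y, hy⟩ := hsub _ (hN N le_rfl)
    obtain ⟨s2, -⟩ := hsub _ (hN (N+1) (Nat.le_succ N))
    have := hφ.injective (hinj _ _ ⟨y, s1 hy, s2 hy⟩)
    omega
  obtain ⟨n, hn⟩ := hex
  set p : ℂ → ℂ := fun z => c n * prodFn (Function.update c n 0) z with hp
  have hcs' := summable_update c hcs n
  have hcn : c n ≠ 0 := by simpa [c] using ha0 n
  refine no_log_frontier_s2 (U n) (hUb n) (a n) (haU n) p ?_ ?_ (hUo n)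
    (fun z => G z + log (h z)) ?_ ?_
  · have := (prodFn_diff _ hcs').continuous
    exact (continuous_const.mul this).continuousOn
  · intro z hz
    refine mul_ne_zero hcn (prodFn_ne_zero _ hcs' z fun m => ?_)
    by_cases hm : m = n
    · subst hm; simp
    · rw [Function.update_of_ne hm]
      refine hcz m z ?_
      rintro rfl
      exact hne n m hm hz
  · refine hG.continuousOn.add (hhc.continuousOn.clog fun z hz => ?_)
    have := hn z hz
    have h2 := Complex.mem_slitPlane_of_norm_lt_one this
    simpa using h2
  · intro z hz
    have h1 := hn z hz
    have h0 : h z ≠ 0 := by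
      intro h0; rw [h0] at h1; norm_num at h1
    rw [exp_add, exp_log h0]
    have : exp (G z) * h z = f z := by
      simp only [h]
      rw [mul_comm, mul_assoc, ← exp_add]; simp
    rw [this, hf, prodFn_factor c hcs n]
    simp only [p]
    have h3 : 1 + c n * z = (z - a n) * c n := by
      have := ha0 n
      simp only [c]; field_simp; ring
    rw [h3]; ring

theorem exists_log_imp_arakelian (F : Set ℂ) (hF : IsClosed F)
    (hlog : ∀ f : ℂ → ℂ, ContinuousOn f F → DifferentiableOn ℂ f (interior F) →
      (∀ z ∈ F, f z ≠ 0) →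
      ∃ g : ℂ → ℂ, ContinuousOn g F ∧ DifferentiableOn ℂ g (interior F) ∧
        ∀ z ∈ F, Complex.exp (g z) = f z) :
    IsArakelian F := by
  refine ⟨?_, ?_⟩
  · intro a ha hb
    obtain ⟨g, hg, -, hge⟩ := hlog (fun z => z - a) (by fun_prop) (by fun_prop)
      (fun z hz h0 => ha (by rw [sub_eq_zero] at h0; exact h0 ▸ hz))
    have hfr : frontier (connectedComponentIn Fᶜ a) ⊆ F := by
      simpa using frontier_comp Fᶜ hF.isOpen_compl a
    exact no_log_frontier_s2 _ hb a (mem_connectedComponentIn ha) (fun _ => 1) continuousOn_const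
      (fun _ _ => one_ne_zero) hF.isOpen_compl.connectedComponentIn g (hg.mono hfr)
      (fun z hz => by rw [hge z (hfr hz), mul_one])
  · intro K hK
    obtain ⟨r, hr⟩ := hK.isBounded.subset_closedBall 0
    set R := max r 1 with hRdef
    have hR : 0 < R := lt_of_lt_of_le one_pos (le_max_right _ _)
    have hKD : K ⊆ closedBall 0 R := hr.trans (closedBall_subset_closedBall (le_max_left _ _))
    refine ((disc_case F hF hlog R hR).union (isBounded_closedBall (x := (0:ℂ)) (r := R))).subset ?_
    rintro z ⟨hz1, hz2⟩
    by_cases hzD : z ∈ closedBall (0:ℂ) R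
    · exact Or.inr hzD
    · refine Or.inl ⟨fun h => h.elim (fun h => hz1 (Or.inl h)) hzD, hz2.subset ?_⟩
      exact connectedComponentIn_mono z
        (Set.compl_subset_compl.2 (Set.union_subset_union_right F hKD))
end
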